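/- Let β and ρ be simple closed curves in ℝ² with β ∩ ρ ≠ ∅, and suppose that every point of β ∩ ρ is a crossing of β and ρ. Let b be a point of β that is not in ρ, and let r be a point of ρ that is not in β. Then there exists a digon (α, γ) of (β, ρ) such that α ∪ γ contains neither b nor r. -/

import Mathlib

/-- A simple closed curve: a subset of ℝ² homeomorphic to the unit circle. -/
def IsSimpleClosedCurve (c : Set (ℝ × ℝ)) : Prop :=
  Nonempty (c ≃ₜ Metric.sphere (0 : EuclideanSpace ℝ (Fin 2)) 1)

/-- An arc: a subset of ℝ² homeomorphic to the closed interval [0,1]. -/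
def IsArc (A : Set (ℝ × ℝ)) : Prop :=
  Nonempty (A ≃ₜ Set.Icc (0 : ℝ) 1)

/-- `a` is an endpoint of the arc `A` : `a ∈ A` and `A \ {a}` is connected. -/
def IsEndpointOf (a : ℝ × ℝ) (A : Set (ℝ × ℝ)) : Prop :=
  a ∈ A ∧ IsConnected (A \ {a})

/-- A digon of the pair of simple closed curves `(β, ρ)`. -/
def IsDigon (β ρ α γ : Set (ℝ × ℝ)) : Prop :=
  IsArc α ∧ IsArc γ ∧ α ⊆ β ∧ γ ⊆ ρ ∧
  ∃ x y : ℝ × ℝ, x ≠ y ∧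
    {a | IsEndpointOf a α} = {x, y} ∧
    {a | IsEndpointOf a γ} = {x, y} ∧
    β ∩ γ = {x, y} ∧
    ρ ∩ α = {x, y}

/-- `z` is a crossing of `β` and `ρ`. -/
def IsCrossing (β ρ : Set (ℝ × ℝ)) (z : ℝ × ℝ) : Prop :=
  ∃ (U : Set (ℝ × ℝ)) (_ : IsOpen U) (hz : z ∈ U) (h : U ≃ₜ ℝ × ℝ),
    h ⟨z, hz⟩ = (0, 0) ∧
    ⇑h '' {p : U | (p : ℝ × ℝ) ∈ β} = {q : ℝ × ℝ | q.2 = 0} ∧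
    ⇑h '' {p : U | (p : ℝ × ℝ) ∈ ρ} = {q : ℝ × ℝ | q.1 = 0}

/-- `z` is a tangential intersection of `β` and `ρ`. -/
def IsTangential (β ρ : Set (ℝ × ℝ)) (z : ℝ × ℝ) : Prop :=
  ∃ (U : Set (ℝ × ℝ)) (_ : IsOpen U) (hz : z ∈ U) (h : U ≃ₜ ℝ × ℝ),
    h ⟨z, hz⟩ = (0, 0) ∧
    ⇑h '' {p : U | (p : ℝ × ℝ) ∈ β} = {q : ℝ × ℝ | q.2 = 0} ∧
    ⇑h '' {p : U | (p : ℝ × ℝ) ∈ ρ} ⊆ {q : ℝ × ℝ | 0 ≤ q.2} ∧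
    ⇑h '' {p : U | (p : ℝ × ℝ) ∈ ρ} ∩ {q : ℝ × ℝ | q.2 = 0} = {((0 : ℝ), (0 : ℝ))}

open Set Topology Metric

/-- `φ` admits a continuous logarithm on `S`. -/
def HasLogOn (φ : ℂ → ℂ) (S : Set ℂ) : Prop :=
  ∃ L : ℂ → ℂ, ContinuousOn L S ∧ ∀ z ∈ S, Complex.exp (L z) = φ z

theorem HasLogOn.mono {φ : ℂ → ℂ} {S T : Set ℂ} (h : HasLogOn φ T) (hST : S ⊆ T) :
    HasLogOn φ S :=
  let ⟨L, hL, he⟩ := h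
  ⟨L, hL.mono hST, fun z hz => he z (hST hz)⟩

theorem hasLogOn_of_continuousMap {φ : ℂ → ℂ} {S : Set ℂ}
    (h : ∃ L : C(S, ℂ), ∀ z, Complex.exp (L z) = φ z) : HasLogOn φ S := by
  classical
  obtain ⟨L, hL⟩ := h
  refine ⟨fun z => if hz : z ∈ S then L ⟨z, hz⟩ else 0, ?_, fun z hz => ?_⟩
  · rw [continuousOn_iff_continuous_domRestrict]
    convert L.continuous using 1
    ext z
    simp
  · simp only [hz, dif_pos]
    exact hL ⟨z, hz⟩

/-- Continuous logarithms propagate along homotopies of nonvanishing functions. -/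
theorem exists_log_of_homotopy {X : Type*} [TopologicalSpace X] (H : C(unitInterval × X, ℂ))
    (hH : ∀ p, H p ≠ 0) (L₀ : C(X, ℂ)) (h₀ : ∀ x, Complex.exp (L₀ x) = H (0, x)) :
    ∃ L : C(X, ℂ), ∀ x, Complex.exp (L x) = H (1, x) := by
  let H' : C(unitInterval × X, {z : ℂ // z ≠ 0}) :=
    ⟨fun p => ⟨H p, hH p⟩, H.continuous.subtype_mk _⟩
  have h0 : ∀ x, H' (0, x) = (fun z : ℂ => (⟨_, z.exp_ne_zero⟩ : {z : ℂ // z ≠ 0})) (L₀ x) :=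
    fun x => Subtype.ext (h₀ x).symm
  refine ⟨(Complex.isCoveringMap_exp.liftHomotopy H' L₀ h0).comp
    ⟨fun x => (1, x), by fun_prop⟩, fun x => ?_⟩
  have := congrFun (Complex.isCoveringMap_exp.liftHomotopy_lifts H' L₀ h0) (1, x)
  exact congrArg Subtype.val this

theorem exists_log_of_contractible {X : Type*} [TopologicalSpace X] [ContractibleSpace X]
    (φ : C(X, ℂ)) (hφ : ∀ x, φ x ≠ 0) : ∃ L : C(X, ℂ), ∀ x, Complex.exp (L x) = φ x := by
  obtain ⟨c, ⟨F⟩⟩ := id_nullhomotopic X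
  obtain ⟨L, hL⟩ := exists_log_of_homotopy (φ.comp F.symm.toContinuousMap) (fun p => hφ _)
    (ContinuousMap.const X (Complex.log (φ c))) (fun x => by simp [Complex.exp_log (hφ c)])
  exact ⟨L, fun x => by simpa using hL x⟩

theorem hasLogOn_of_contractible {φ : ℂ → ℂ} {S : Set ℂ} [ContractibleSpace S]
    (hc : ContinuousOn φ S) (h0 : ∀ z ∈ S, φ z ≠ 0) : HasLogOn φ S := by
  apply hasLogOn_of_continuousMap
  exact exists_log_of_contractible ⟨S.domRestrict φ, continuousOn_iff_continuous_domRestrict.1 hc⟩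
    fun z => h0 z z.2

theorem eqOn_const_of_exp_eq_one {X : Type*} [TopologicalSpace X] {S : Set X}
    (hS : IsPreconnected S) {f : X → ℂ} (hf : ContinuousOn f S)
    (h : ∀ x ∈ S, Complex.exp (f x) = 1) : ∀ x ∈ S, ∀ y ∈ S, f x = f y := by
  have hcount : {z : ℂ | Complex.exp z = 1}.Countable := by
    refine (countable_range fun n : ℤ => (n : ℂ) * (2 * Real.pi * Complex.I)).mono ?_
    intro z hz
    obtain ⟨n, hn⟩ := Complex.exp_eq_one_iff.1 hz
    exact ⟨n, hn.symm⟩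
  intro x hx y hy
  exact hcount.isTotallyDisconnected (f '' S) (by rintro _ ⟨x, hx, rfl⟩; exact h x hx)
    (hS.image f hf) ⟨x, hx, rfl⟩ ⟨y, hy, rfl⟩

/-- Around a circle, `z - p` has no continuous logarithm. -/
theorem not_hasLogOn_sphere (p : ℂ) {R : ℝ} (hR : 0 < R) :
    ¬ HasLogOn (fun z => z - p) (sphere p R) := by
  rintro ⟨L, hL, he⟩
  let c : ℝ → ℂ := fun θ => circleMap p R θ
  have hc : Continuous c := continuous_circleMap p R
  have hmem : ∀ θ, c θ ∈ sphere p R := fun θ => circleMap_mem_sphere p hR.le θ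
  let f : ℝ → ℂ := fun θ => L (c θ) - θ * Complex.I - Real.log R
  have hf : Continuous f := by
    have : Continuous fun θ => L (c θ) := hL.comp_continuous hc hmem
    exact (this.sub (by fun_prop)).sub continuous_const
  have h1 : ∀ θ, Complex.exp (f θ) = 1 := by
    intro θ
    have : Complex.exp (Real.log R) = R := by
      rw [← Complex.ofReal_exp, Real.exp_log hR]
    simp only [f, Complex.exp_sub, he _ (hmem θ), this]
    simp only [c, circleMap]
    have hR' : (R : ℂ) ≠ 0 := by exact_mod_cast hR.ne'
    field_simp
    ring
  have := eqOn_const_of_exp_eq_one isPreconnected_univ hf.continuousOn (fun x _ => h1 x)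
    0 (mem_univ _) (2 * Real.pi) (mem_univ _)
  have hper : c (2 * Real.pi) = c 0 := by simp [c, circleMap]
  simp only [f, hper] at this
  have h2 := congrArg Complex.im this
  simp at h2
  linarith [Real.pi_pos]

/-- Continuous logarithms glue along a preconnected intersection. -/
theorem HasLogOn.union {φ : ℂ → ℂ} {A B : Set ℂ} (hA : HasLogOn φ A) (hB : HasLogOn φ B)
    (hAB : IsPreconnected (A ∩ B))
    (hoc : (IsClosed A ∧ IsClosed B) ∨ (IsOpen A ∧ IsOpen B)) : HasLogOn φ (A ∪ B) := by
  classical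
  obtain ⟨L, hL, hLe⟩ := hA
  obtain ⟨M, hM, hMe⟩ := hB
  obtain ⟨k, hk, hkk⟩ : ∃ k : ℂ, Complex.exp k = 1 ∧ ∀ z ∈ A ∩ B, L z = M z + k := by
    rcases (A ∩ B).eq_empty_or_nonempty with h | ⟨w, hw⟩
    · exact ⟨0, by simp, by simp [h]⟩
    · have h1 : ∀ z ∈ A ∩ B, Complex.exp (L z - M z) = 1 := by
        intro z hz
        rw [Complex.exp_sub, hLe z hz.1, ← hMe z hz.2, div_self (Complex.exp_ne_zero _)]
      refine ⟨L w - M w, h1 w hw, fun z hz => ?_⟩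
      have := eqOn_const_of_exp_eq_one hAB
        (f := fun z => L z - M z) ((hL.mono inter_subset_left).sub (hM.mono inter_subset_right))
        h1 z hz w hw
      linear_combination this
  let N : ℂ → ℂ := fun z => if z ∈ A then L z else M z + k
  have hNA : EqOn N L A := fun z hz => by simp [N, hz]
  have hNB : EqOn N (fun z => M z + k) B := by
    intro z hz
    by_cases h : z ∈ A
    · simp [N, h, hkk z ⟨h, hz⟩]
    · simp [N, h]
  have cA : ContinuousOn N A := hL.congr hNA
  have cB : ContinuousOn N B := (hM.add continuousOn_const).congr hNB
  refine ⟨N, ?_, ?_⟩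
  · rcases hoc with ⟨a, b⟩ | ⟨a, b⟩
    · exact cA.union_of_isClosed cB a b
    · exact cA.union_of_isOpen cB a b
  · rintro z (hz | hz)
    · rw [hNA hz, hLe z hz]
    · rw [hNB hz, Complex.exp_add, hk, mul_one, hMe z hz]

/-- Points joined by a connected set disjoint from `K` have a logarithmic quotient on `K`. -/
theorem hasLogOn_of_isPreconnected {K S : Set ℂ} (hK : IsClosed K) (hS : IsPreconnected S)
    (hd : Disjoint S K) {p q : ℂ} (hp : p ∈ S) (hq : q ∈ S) :
    HasLogOn (fun z => (z - p) / (z - q)) K := by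
  have hne : ∀ x ∈ S, ∀ z ∈ K, z - x ≠ 0 := fun x hx z hz h =>
    disjoint_left.1 hd hx (sub_eq_zero.1 h ▸ hz)
  refine hS.induction₂ (fun p q => HasLogOn (fun z => (z - p) / (z - q)) K) ?_ ?_ ?_ hp hq
  · intro x hx
    have hxK : x ∉ K := disjoint_left.1 hd hx
    obtain ⟨ε, hε, hb⟩ := Metric.isOpen_iff.1 hK.isOpen_compl x hxK
    have : ∀ᶠ y in 𝓝[S] x, y ∈ ball x ε ∩ S :=
      Filter.inter_mem (mem_nhdsWithin_of_mem_nhds (ball_mem_nhds x hε)) self_mem_nhdsWithin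
    filter_upwards [this] with y hy
    have hslit : ∀ z ∈ K, (z - y) / (z - x) ∈ Complex.slitPlane := by
      intro z hz
      have h1 : ‖(z - y) / (z - x) - 1‖ < 1 := by
        have h0 := hne x hx z hz
        have : (z - y) / (z - x) - 1 = (x - y) / (z - x) := by field_simp; ring
        rw [this, norm_div, div_lt_one (norm_pos_iff.2 h0)]
        have h2 : ε ≤ ‖z - x‖ := by
          by_contra h
          exact hb (show z ∈ ball x ε by rw [mem_ball, dist_eq_norm]; linarith) hz
        have h3 : ‖x - y‖ < ε := by rw [← dist_eq_norm, dist_comm]; exact hy.1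
        linarith
      have := Complex.mem_slitPlane_of_norm_lt_one h1
      simpa using this
    refine ⟨fun z => -Complex.log ((z - y) / (z - x)), ?_, fun z hz => ?_⟩
    · refine (ContinuousOn.clog ?_ hslit).neg
      exact ContinuousOn.div (by fun_prop) (by fun_prop) (fun z hz => hne x hx z hz)
    · have h0 := hne x hx z hz
      have h1 := hne y hy.2 z hz
      rw [Complex.exp_neg, Complex.exp_log (div_ne_zero h1 h0), inv_div]
  · rintro x y w hx hy hw ⟨L, hL, hLe⟩ ⟨M, hM, hMe⟩
    refine ⟨fun z => L z + M z, hL.add hM, fun z hz => ?_⟩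
    have := hne y hy z hz
    have := hne w hw z hz
    rw [Complex.exp_add, hLe z hz, hMe z hz]
    field_simp
  · rintro x y hx hy ⟨L, hL, hLe⟩
    refine ⟨fun z => - L z, hL.neg, fun z hz => ?_⟩
    rw [Complex.exp_neg, hLe z hz, inv_div]

theorem disjoint_connectedComponentIn {X : Type*} [TopologicalSpace X] {F : Set X} {x y : X}
    (h : connectedComponentIn F x ≠ connectedComponentIn F y) :
    Disjoint (connectedComponentIn F x) (connectedComponentIn F y) := by
  rw [disjoint_left]
  intro z hx hy
  exact h ((connectedComponentIn_eq hx).trans (connectedComponentIn_eq hy).symm)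

theorem frontier_connectedComponentIn_subset {X : Type*} [TopologicalSpace X]
    [LocallyConnectedSpace X] {F : Set X} (hF : IsOpen F) (x : X) :
    frontier (connectedComponentIn F x) ⊆ Fᶜ := by
  intro z hz hzF
  rw [hF.connectedComponentIn.frontier_eq] at hz
  obtain ⟨w, hw, hw'⟩ := mem_closure_iff.1 hz.1 _ (hF.connectedComponentIn (x := z))
    (mem_connectedComponentIn hzF)
  have := (connectedComponentIn_eq hw').trans (connectedComponentIn_eq hw).symm
  exact hz.2 (this ▸ mem_connectedComponentIn hzF)

theorem isPreconnected_norm_gt (R : ℝ) (hR : 0 ≤ R) : IsPreconnected {z : ℂ | R < ‖z‖} := by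
  have : {z : ℂ | R < ‖z‖} =
      (fun p : ℝ × ℝ => (p.1 : ℂ) * Complex.exp (p.2 * Complex.I)) '' (Ioi R ×ˢ univ) := by
    ext z
    constructor
    · intro hz
      exact ⟨(‖z‖, z.arg), ⟨hz, mem_univ _⟩, Complex.norm_mul_exp_arg_mul_I z⟩
    · rintro ⟨⟨r, θ⟩, ⟨hr, -⟩, rfl⟩
      simp only [mem_Ioi] at hr
      simp [Complex.norm_exp_ofReal_mul_I, abs_of_pos (hR.trans_lt hr), hr]
  rw [this]
  exact (isPreconnected_Ioi.prod isPreconnected_univ).image _ (by fun_prop)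

theorem not_hasLogOn_of_isBounded {K : Set ℂ} (hK : IsClosed K) {p q : ℂ} (hp : p ∉ K)
    (hbd : Bornology.IsBounded (connectedComponentIn Kᶜ p)) (hq : q ∉ connectedComponentIn Kᶜ p) :
    ¬ HasLogOn (fun z => (z - p) / (z - q)) K := by
  classical
  rintro ⟨L, hL, hLe⟩
  set C := connectedComponentIn Kᶜ p with hC
  have hpC : p ∈ C := mem_connectedComponentIn hp
  have hCo : IsOpen C := hK.isOpen_compl.connectedComponentIn
  obtain ⟨F, hF⟩ := ContinuousMap.exists_restrict_eq hK
    (⟨K.domRestrict L, continuousOn_iff_continuous_domRestrict.1 hL⟩ : C(K, ℂ))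
  have hFK : ∀ z ∈ K, F z = L z := fun z hz => by
    exact DFunLike.congr_fun hF ⟨z, hz⟩
  by_cases hqK : q ∈ K
  · have := hLe q hqK
    simp [Complex.exp_ne_zero] at this
  let g : ℂ → ℂ := C.piecewise (fun z => Complex.exp (F z) * (z - q)) (fun z => z - p)
  have hg : Continuous g := by
    refine Continuous.piecewise ?_ (by fun_prop) (by fun_prop)
    intro z hz
    have hzK : z ∈ K := by
      simpa using frontier_connectedComponentIn_subset hK.isOpen_compl p hz
    have : z - q ≠ 0 := fun h => hqK (sub_eq_zero.1 h ▸ hzK)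
    rw [hFK z hzK, hLe z hzK, div_mul_cancel₀ _ this]
  have hg0 : ∀ z, g z ≠ 0 := by
    intro z
    by_cases hz : z ∈ C
    · simp only [g, piecewise_eq_of_mem _ _ _ hz]
      exact mul_ne_zero (Complex.exp_ne_zero _)
        fun h => hq (sub_eq_zero.1 h ▸ hz)
    · simp only [g, piecewise_eq_of_notMem _ _ _ hz]
      exact fun h => hz (sub_eq_zero.1 h ▸ hpC)
  obtain ⟨M, hM⟩ := exists_log_of_contractible ⟨g, hg⟩ hg0
  obtain ⟨R, hR⟩ := hbd.subset_ball p
  have hR0 : 0 < R := by simpa using hR hpC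
  refine not_hasLogOn_sphere p hR0 ⟨M, M.continuous.continuousOn, fun z hz => ?_⟩
  have hzC : z ∉ C := fun h => by
    have := hR h
    rw [mem_ball, mem_sphere.1 hz] at this
    exact lt_irrefl _ this
  exact (hM z).trans (show g z = z - p from piecewise_eq_of_notMem _ _ _ hzC)

/-- Eilenberg's criterion: if `(z - p) / (z - q)` has a continuous logarithm on the compact
set `K`, then `K` does not separate `p` from `q`. -/
theorem connectedComponentIn_eq_of_hasLogOn {K : Set ℂ} (hK : IsCompact K) {p q : ℂ}
    (hp : p ∉ K) (hq : q ∉ K) (h : HasLogOn (fun z => (z - p) / (z - q)) K) :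
    connectedComponentIn Kᶜ p = connectedComponentIn Kᶜ q := by
  by_contra hne
  have hdis := disjoint_connectedComponentIn hne
  have hpC : p ∈ connectedComponentIn Kᶜ p := mem_connectedComponentIn hp
  have hqC : q ∈ connectedComponentIn Kᶜ q := mem_connectedComponentIn hq
  have hp' : ¬ Bornology.IsBounded (connectedComponentIn Kᶜ p) := fun hb =>
    not_hasLogOn_of_isBounded hK.isClosed hp hb (disjoint_right.1 hdis hqC) h
  have hq' : ¬ Bornology.IsBounded (connectedComponentIn Kᶜ q) := fun hb => by
    refine not_hasLogOn_of_isBounded hK.isClosed hq hb (disjoint_left.1 hdis hpC) ?_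
    obtain ⟨L, hL, hLe⟩ := h
    refine ⟨fun z => - L z, hL.neg, fun z hz => ?_⟩
    rw [Complex.exp_neg, hLe z hz, inv_div]
  obtain ⟨R, hR0, hR⟩ := hK.isBounded.exists_pos_norm_le
  have key : ∀ x, ¬ Bornology.IsBounded (connectedComponentIn Kᶜ x) →
      {z : ℂ | R < ‖z‖} ⊆ connectedComponentIn Kᶜ x := by
    intro x hx
    obtain ⟨z, hz, hzR⟩ : ∃ z ∈ connectedComponentIn Kᶜ x, R < ‖z‖ := by
      by_contra! hcon
      exact hx (isBounded_iff_forall_norm_le.2 ⟨R, hcon⟩)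
    rw [connectedComponentIn_eq hz]
    exact (isPreconnected_norm_gt R hR0.le).subset_connectedComponentIn hzR
      fun w hw hwK => (hR w hwK).not_gt hw
  have hmem : ((R + 1 : ℝ) : ℂ) ∈ {z : ℂ | R < ‖z‖} := by
    change R < ‖((R + 1 : ℝ) : ℂ)‖
    rw [Complex.norm_real, Real.norm_eq_abs, abs_of_pos (by linarith)]
    linarith
  exact disjoint_left.1 hdis (key p hp' hmem) (key q hq' hmem)

/-- A `1`-periodic continuous parametrization of a simple closed curve. -/
structure IsCurveParam {X : Type*} [TopologicalSpace X] (g : ℝ → X) : Prop where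
  continuous : Continuous g
  eq_iff : ∀ s t, g s = g t ↔ ∃ n : ℤ, s - t = n

namespace IsCurveParam

variable {X : Type*} [TopologicalSpace X] {g : ℝ → X}

theorem comp_add (hg : IsCurveParam g) (c : ℝ) : IsCurveParam fun t => g (t + c) where
  continuous := hg.continuous.comp (by fun_prop)
  eq_iff s t := by rw [hg.eq_iff]; simp

theorem comp_homeomorph {Y : Type*} [TopologicalSpace Y] (hg : IsCurveParam g) (e : X ≃ₜ Y) :
    IsCurveParam fun t => e (g t) where
  continuous := e.continuous.comp hg.continuous
  eq_iff s t := by rw [e.injective.eq_iff, hg.eq_iff]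

theorem apply_add_one (hg : IsCurveParam g) (t : ℝ) : g (t + 1) = g t :=
  (hg.eq_iff _ _).2 ⟨1, by simp⟩

theorem eq_of_abs_lt (hg : IsCurveParam g) {s t : ℝ} (h : g s = g t) (hst : |s - t| < 1) :
    s = t := by
  obtain ⟨n, hn⟩ := (hg.eq_iff s t).1 h
  rw [hn] at hst
  have : |n| < 1 := by exact_mod_cast hst
  rw [Int.abs_lt_one_iff.1 this] at hn
  simpa [sub_eq_zero] using hn

theorem injOn_Icc (hg : IsCurveParam g) {a b : ℝ} (hab : b < a + 1) : InjOn g (Icc a b) := by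
  intro s hs t ht h
  refine hg.eq_of_abs_lt h (abs_lt.2 ⟨?_, ?_⟩) <;> linarith [hs.1, hs.2, ht.1, ht.2]

theorem eq_of_mem_Ioo (hg : IsCurveParam g) {s t : ℝ} (h : g s = g t) (hs : s ∈ Ioo (0 : ℝ) 1)
    (ht : t ∈ Ioo (0 : ℝ) 1) : s = t := by
  refine hg.eq_of_abs_lt h (abs_lt.2 ⟨?_, ?_⟩) <;> linarith [hs.1, hs.2, ht.1, ht.2]

theorem exists_mem_Ico (hg : IsCurveParam g) (a t : ℝ) : ∃ s ∈ Ico a (a + 1), g s = g t := by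
  refine ⟨toIcoMod one_pos a t, toIcoMod_mem_Ico _ _ _, (hg.eq_iff _ _).2
    ⟨-toIcoDiv one_pos a t, ?_⟩⟩
  have := toIcoMod_add_toIcoDiv_zsmul one_pos a t
  simp only [zsmul_eq_mul, mul_one] at this
  push_cast
  linarith

theorem range_eq (hg : IsCurveParam g) (a : ℝ) : range g = g '' Icc a (a + 1) := by
  refine (image_subset_range _ _).antisymm' ?_
  rintro _ ⟨t, rfl⟩
  obtain ⟨s, hs, h⟩ := hg.exists_mem_Ico a t
  exact ⟨s, Ico_subset_Icc_self hs, h⟩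

theorem isCompact_range (hg : IsCurveParam g) : IsCompact (range g) := by
  rw [hg.range_eq 0]
  exact isCompact_Icc.image hg.continuous

theorem exists_mem_Ioo (hg : IsCurveParam g) {x : X} (hx : x ∈ range g) (h0 : x ≠ g 0) :
    ∃ s ∈ Ioo (0 : ℝ) 1, g s = x := by
  obtain ⟨t, rfl⟩ := hx
  obtain ⟨s, hs, h⟩ := hg.exists_mem_Ico 0 t
  refine ⟨s, ⟨lt_of_le_of_ne hs.1 ?_, by simpa using hs.2⟩, h⟩
  rintro rfl
  exact h0 h.symm

end IsCurveParam

theorem contractibleSpace_image_Icc {X : Type*} [TopologicalSpace X] [T2Space X] {g : ℝ → X}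
    {a b : ℝ} (hab : a ≤ b) (hg : ContinuousOn g (Icc a b)) (hi : InjOn g (Icc a b)) :
    ContractibleSpace (g '' Icc a b) := by
  have : ContractibleSpace (Icc a b) := (convex_Icc a b).contractibleSpace (nonempty_Icc.2 hab)
  have hc : Continuous ((Icc a b).domRestrict g) := continuousOn_iff_continuous_domRestrict.1 hg
  have hinj : Function.Injective ((Icc a b).domRestrict g) := injOn_iff_injective.1 hi
  have e := (hc.isClosedEmbedding hinj).isEmbedding.toHomeomorph
  have hr : range ((Icc a b).domRestrict g) = g '' Icc a b := range_domRestrict g _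
  rw [← hr]
  exact e.symm.contractibleSpace

/-- An arc does not separate the plane. -/
theorem isPreconnected_compl_image_Icc {g : ℝ → ℂ} {a b : ℝ} (hab : a ≤ b)
    (hg : ContinuousOn g (Icc a b)) (hi : InjOn g (Icc a b)) :
    IsPreconnected (g '' Icc a b)ᶜ := by
  have := contractibleSpace_image_Icc hab hg hi
  rcases (g '' Icc a b)ᶜ.eq_empty_or_nonempty with h | ⟨q, hq⟩
  · rw [h]; exact isPreconnected_empty
  have : (g '' Icc a b)ᶜ = connectedComponentIn (g '' Icc a b)ᶜ q := by
    refine Subset.antisymm (fun p hp => ?_) (connectedComponentIn_subset _ _)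
    have hne : ∀ x ∉ g '' Icc a b, ∀ z ∈ g '' Icc a b, z - x ≠ 0 := fun x hx z hz h =>
      hx (sub_eq_zero.1 h ▸ hz)
    rw [← connectedComponentIn_eq_of_hasLogOn (isCompact_Icc.image_of_continuousOn hg) hp hq
      (hasLogOn_of_contractible
        (ContinuousOn.div (by fun_prop) (by fun_prop) (hne q hq))
        fun z hz => div_ne_zero (hne p hp z hz) (hne q hq z hz))]
    exact mem_connectedComponentIn hp
  rw [this]
  exact isPreconnected_connectedComponentIn

theorem hasLogOn_compl_image_Icc {g : ℝ → ℂ} (hg : Continuous g) (a b : ℝ) (hab : a ≤ b) :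
    HasLogOn (fun z => (z - g b) / (z - g a)) (g '' Icc a b)ᶜ := by
  apply hasLogOn_of_continuousMap
  have hmem : ∀ t : unitInterval, a + t * (b - a) ∈ Icc a b := fun t =>
    ⟨by nlinarith [t.2.1], by nlinarith [t.2.2]⟩
  have hne : ∀ (t : unitInterval) (z : ↥((g '' Icc a b)ᶜ)), (z : ℂ) - g (a + t * (b - a)) ≠ 0 :=
    fun t z h => z.2 ⟨_, hmem t, (sub_eq_zero.1 h).symm⟩
  have hne' : ∀ z : ↥((g '' Icc a b)ᶜ), (z : ℂ) - g a ≠ 0 := fun z => by simpa using hne 0 z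
  obtain ⟨L, hL⟩ := exists_log_of_homotopy (X := ↥((g '' Icc a b)ᶜ))
    ⟨fun p => (p.2 - g (a + p.1 * (b - a))) / (p.2 - g a), by
      refine Continuous.div ?_ ?_ fun p => hne' p.2
      · exact (by fun_prop : Continuous _).sub (hg.comp (by fun_prop))
      · fun_prop⟩
    (fun p => div_ne_zero (hne p.1 p.2) (hne' p.2)) (ContinuousMap.const _ 0)
    (fun z => by simp [hne' z])
  exact ⟨L, fun z => by simpa using hL z⟩

/-- The complement of a simple closed curve is disconnected. -/
theorem IsCurveParam.not_isPreconnected_compl {g : ℝ → ℂ} (hg : IsCurveParam g) :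
    ¬ IsPreconnected (range g)ᶜ := by
  intro hpre
  set x := g 0
  set y := g (1 / 2)
  have hxy : x ≠ y := fun h => by
    have := hg.eq_of_abs_lt h (by norm_num [abs_lt])
    norm_num at this
  have hunion : g '' Icc 0 (1 / 2) ∪ g '' Icc (1 / 2) 1 = range g := by
    rw [← image_union, Icc_union_Icc_eq_Icc (by norm_num) (by norm_num), hg.range_eq 0, zero_add]
  have hinter : g '' Icc 0 (1 / 2) ∩ g '' Icc (1 / 2) 1 ⊆ {x, y} := by
    rintro _ ⟨⟨s, hs, rfl⟩, t, ht, h⟩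
    obtain ⟨n, hn⟩ := (hg.eq_iff _ _).1 h
    have h1 : (n : ℝ) ≤ 1 := by linarith [hs.1, hs.2, ht.1, ht.2]
    have h2 : (0 : ℝ) ≤ n := by linarith [hs.1, hs.2, ht.1, ht.2]
    have h1' : n ≤ 1 := by exact_mod_cast h1
    have h2' : 0 ≤ n := by exact_mod_cast h2
    obtain rfl | rfl : n = 0 ∨ n = 1 := by omega
    · right
      have : s = 1 / 2 := by push_cast at hn; linarith [hs.2, ht.1]
      simp [this, y]
    · left
      have : s = 0 := by push_cast at hn; linarith [hs.1, ht.2]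
      simp [this, x]
  have h1 := hasLogOn_compl_image_Icc hg.continuous 0 (1 / 2) (by norm_num)
  have h2 : HasLogOn (fun z => (z - y) / (z - x)) (g '' Icc (1 / 2) 1)ᶜ := by
    obtain ⟨L, hL, hLe⟩ := hasLogOn_compl_image_Icc hg.continuous (1 / 2) 1 (by norm_num)
    refine ⟨fun z => - L z, hL.neg, fun z hz => ?_⟩
    have : g 1 = x := by simpa using hg.apply_add_one 0
    rw [Complex.exp_neg, hLe z hz, inv_div, this]
  have hclosed : ∀ a b, IsClosed (g '' Icc a b) := fun a b =>
    (isCompact_Icc.image hg.continuous).isClosed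
  have h3 := HasLogOn.union h1 h2 (by rwa [← compl_union, hunion])
    (Or.inr ⟨(hclosed _ _).isOpen_compl, (hclosed _ _).isOpen_compl⟩)
  rw [← compl_inter] at h3
  have hr : 0 < dist x y / 2 := half_pos (dist_pos.2 hxy)
  have hby : ∀ z ∈ closedBall x (dist x y / 2), z ≠ y := by
    rintro z hz rfl
    rw [mem_closedBall, dist_comm] at hz
    linarith
  have : ContractibleSpace (closedBall x (dist x y / 2)) :=
    (convex_closedBall _ _).contractibleSpace ⟨x, mem_closedBall_self hr.le⟩
  obtain ⟨M, hM, hMe⟩ : HasLogOn (fun z => z - y) (sphere x (dist x y / 2)) :=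
    (hasLogOn_of_contractible (by fun_prop) fun z hz => sub_ne_zero.2 (hby z hz)).mono
      sphere_subset_closedBall
  have hsub : sphere x (dist x y / 2) ⊆ (g '' Icc 0 (1 / 2) ∩ g '' Icc (1 / 2) 1)ᶜ := by
    intro z hz hz'
    rcases hinter hz' with rfl | rfl
    · rw [mem_sphere, dist_self] at hz
      linarith
    · exact hby _ (sphere_subset_closedBall hz) rfl
  obtain ⟨L, hL, hLe⟩ := h3.mono hsub
  refine not_hasLogOn_sphere x hr ⟨fun z => M z - L z, hM.sub hL, fun z hz => ?_⟩
  have hzx : z - x ≠ 0 := fun h => by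
    rw [sub_eq_zero.1 h, mem_sphere, dist_self] at hz
    linarith
  have hzy : z - y ≠ 0 := sub_ne_zero.2 (hby z (sphere_subset_closedBall hz))
  rw [Complex.exp_sub, hMe z hz, hLe z hz]
  change (z - y) / ((z - y) / (z - x)) = z - x
  field_simp

theorem IsCurveParam.exists_connectedComponentIn_ne {g : ℝ → ℂ} (hg : IsCurveParam g) (p : ℂ) :
    ∃ q ∉ range g, connectedComponentIn (range g)ᶜ q ≠ connectedComponentIn (range g)ᶜ p := by
  by_contra! h
  apply hg.not_isPreconnected_compl
  have : (range g)ᶜ = connectedComponentIn (range g)ᶜ p := by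
    refine Subset.antisymm (fun q hq => ?_) (connectedComponentIn_subset _ _)
    rw [← h q hq]
    exact mem_connectedComponentIn hq
  rw [this]
  exact isPreconnected_connectedComponentIn

theorem IsCurveParam.apply_zero_mem_closure {g : ℝ → ℂ} (hg : IsCurveParam g) {p : ℂ}
    (hp : p ∉ range g) : g 0 ∈ closure (connectedComponentIn (range g)ᶜ p) := by
  by_contra hcl
  obtain ⟨q, hq, hne⟩ := hg.exists_connectedComponentIn_ne p
  set C := connectedComponentIn (range g)ᶜ p
  have hopen : IsOpen (range g)ᶜ := hg.isCompact_range.isClosed.isOpen_compl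
  have hCo : IsOpen C := hopen.connectedComponentIn
  have hqC : q ∉ C := disjoint_left.1 (disjoint_connectedComponentIn hne)
    (mem_connectedComponentIn hq)
  have hnhds : g ⁻¹' (closure C)ᶜ ∈ 𝓝 (0 : ℝ) :=
    (isClosed_closure.isOpen_compl.preimage hg.continuous).mem_nhds hcl
  obtain ⟨ε, hε, hball⟩ := Metric.mem_nhds_iff.1 hnhds
  set δ := min (ε / 2) (1 / 4)
  have hδ0 : 0 < δ := by positivity
  have hδε : δ < ε := (min_le_left _ _).trans_lt (by linarith)
  have hδ4 : δ ≤ 1 / 4 := min_le_right _ _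
  have hA := isPreconnected_compl_image_Icc (g := g) (a := δ) (b := 1 - δ) (by linarith)
    hg.continuous.continuousOn (hg.injOn_Icc (by linarith))
  have hfr : frontier C ⊆ g '' Icc δ (1 - δ) := by
    intro z hz
    have hzr : z ∈ range g := by
      simpa using frontier_connectedComponentIn_subset hopen p hz
    obtain ⟨t, rfl⟩ := hzr
    obtain ⟨s, hs, hst⟩ := hg.exists_mem_Ico (-δ) t
    rw [← hst] at hz ⊢
    have hsb : ¬ s < δ := fun h => by
      refine hball (?_ : s ∈ ball 0 ε) (frontier_subset_closure hz)
      rw [mem_ball_zero_iff, Real.norm_eq_abs, abs_lt]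
      constructor <;> linarith [hs.1]
    exact ⟨s, ⟨not_lt.1 hsb, by linarith [hs.2]⟩, rfl⟩
  have hcover : (g '' Icc δ (1 - δ))ᶜ ⊆ C ∪ (closure C)ᶜ := by
    intro z hz
    by_cases h : z ∈ C
    · exact Or.inl h
    · refine Or.inr fun h' => hz (hfr ?_)
      rw [hCo.frontier_eq]
      exact ⟨h', h⟩
  have hsub : (range g)ᶜ ⊆ (g '' Icc δ (1 - δ))ᶜ := compl_subset_compl.2 (image_subset_range _ _)
  obtain ⟨z, -, hz, hz'⟩ := hA C (closure C)ᶜ hCo isClosed_closure.isOpen_compl hcover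
    ⟨p, hsub hp, mem_connectedComponentIn hp⟩
    ⟨q, hsub hq, (hcover (hsub hq)).resolve_left hqC⟩
  exact hz' (subset_closure hz)

/-- Every point of a simple closed curve is in the closure of each complementary component. -/
theorem IsCurveParam.range_subset_closure {g : ℝ → ℂ} (hg : IsCurveParam g) {p : ℂ}
    (hp : p ∉ range g) : range g ⊆ closure (connectedComponentIn (range g)ᶜ p) := by
  rintro _ ⟨t, rfl⟩
  have hr : range (fun s => g (s + t)) = range g :=
    (Equiv.addRight t).surjective.range_comp g
  have := (hg.comp_add t).apply_zero_mem_closure (p := p) (by rwa [hr])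
  simpa [hr] using this

/-- A chord of the closed curve `M₁ ∪ M₂` crossing the chord `α` cannot lie on the same side. -/
theorem connectedComponentIn_eq_of_crossing_chord {M₁ M₂ α T D : Set ℂ} (h₁ : IsCompact M₁)
    (h₂ : IsCompact M₂) (hα : IsCompact α) (hαc : IsPreconnected α) (hM : M₁ ∩ M₂ ⊆ α)
    (hT : IsPreconnected T) (hD : IsPreconnected D) (hTd : Disjoint T (M₁ ∪ M₂ ∪ α))
    (hDd : Disjoint D (M₁ ∪ M₂ ∪ α)) {c d : ℂ} (hc : c ∉ M₂ ∪ α) (hd : d ∉ M₁ ∪ α)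
    (hcT : c ∈ closure T) (hcD : c ∈ closure D) (hdT : d ∈ closure T) (hdD : d ∈ closure D)
    {u w : ℂ} (hu : u ∈ T) (hw : w ∈ D) :
    connectedComponentIn (M₁ ∪ M₂)ᶜ u = connectedComponentIn (M₁ ∪ M₂)ᶜ w := by
  have hconn : ∀ x, x ∈ closure T → x ∈ closure D → IsPreconnected (insert x T ∪ insert x D) := by
    intro x hxT hxD
    refine IsPreconnected.union x (mem_insert _ _) (mem_insert _ _) ?_ ?_
    · exact hT.subset_closure (subset_insert _ _) (insert_subset hxT subset_closure)
    · exact hD.subset_closure (subset_insert _ _) (insert_subset hxD subset_closure)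
  have hlog : ∀ M x, IsCompact M → M ⊆ M₁ ∪ M₂ → x ∉ M ∪ α → x ∈ closure T → x ∈ closure D →
      HasLogOn (fun z => (z - u) / (z - w)) (M ∪ α) := by
    intro M x hM hMM hx hxT hxD
    refine hasLogOn_of_isPreconnected (hM.union hα).isClosed (hconn x hxT hxD) ?_
      (Or.inl (Or.inr hu)) (Or.inr (Or.inr hw))
    have hs : M ∪ α ⊆ M₁ ∪ M₂ ∪ α := union_subset_union_left _ hMM
    have h1 := hTd.mono_right hs
    have h2 := hDd.mono_right hs
    simp only [disjoint_union_left, disjoint_insert_left]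
    exact ⟨⟨hx, h1⟩, hx, h2⟩
  have hlog₂ := hlog M₂ c h₂ subset_union_right hc hcT hcD
  have hlog₁ := hlog M₁ d h₁ subset_union_left hd hdT hdD
  have hinter : (M₁ ∪ α) ∩ (M₂ ∪ α) = α := by
    rw [← inter_union_distrib_right, union_eq_right.2 hM]
  have := HasLogOn.union hlog₁ hlog₂ (by rwa [hinter])
    (Or.inl ⟨(h₁.union hα).isClosed, (h₂.union hα).isClosed⟩)
  refine connectedComponentIn_eq_of_hasLogOn (h₁.union h₂) ?_ ?_ (this.mono ?_)
  · exact fun h => disjoint_left.1 hTd hu (Or.inl h)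
  · exact fun h => disjoint_left.1 hDd hw (Or.inl h)
  · exact union_subset_union subset_union_left subset_union_left

/-- If `z` is a limit of a complementary component of `ρ`, and `β` crosses `ρ` at `z`, then `β`
enters this component arbitrarily close to `z`. -/
theorem mem_closure_inter_of_crossing {X : Type*} [TopologicalSpace X] {β ρ U : Set X}
    (hU : IsOpen U) {z : X} (hz : z ∈ U) (h : U ≃ₜ ℝ × ℝ) (h0 : h ⟨z, hz⟩ = (0, 0))
    (hβ : h '' {p : U | (p : X) ∈ β} = {q : ℝ × ℝ | q.2 = 0})
    (hρ : h '' {p : U | (p : X) ∈ ρ} = {q : ℝ × ℝ | q.1 = 0}) {y : X}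
    (hy : z ∈ closure (connectedComponentIn ρᶜ y)) :
    z ∈ closure (β ∩ connectedComponentIn ρᶜ y) := by
  have hβ' : ∀ q : ℝ × ℝ, (h.symm q : X) ∈ β ↔ q.2 = 0 := by
    intro q
    have := Set.ext_iff.1 hβ q
    rw [h.image_eq_preimage_symm] at this
    exact this
  have hρ' : ∀ q : ℝ × ℝ, (h.symm q : X) ∈ ρ ↔ q.1 = 0 := by
    intro q
    have := Set.ext_iff.1 hρ q
    rw [h.image_eq_preimage_symm] at this
    exact this
  obtain ⟨w, hwU, hwC⟩ := mem_closure_iff.1 hy U hU hz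
  set σ := (h ⟨w, hwU⟩).1
  have hσ : σ ≠ 0 := by
    intro hσ
    have := (hρ' (h ⟨w, hwU⟩)).2 hσ
    rw [h.symm_apply_apply] at this
    exact connectedComponentIn_subset _ _ hwC this
  have hcont : Continuous fun q : ℝ × ℝ => (h.symm q : X) :=
    continuous_subtype_val.comp h.symm.continuous
  have hconv : Convex ℝ {q : ℝ × ℝ | 0 < q.1 * σ} :=
    convex_halfSpace_gt (f := fun q : ℝ × ℝ => q.1 * σ)
      ⟨fun a b => by simp [add_mul], fun c a => by simp [mul_assoc]⟩ 0
  have hside : (fun q : ℝ × ℝ => (h.symm q : X)) '' {q : ℝ × ℝ | 0 < q.1 * σ} ⊆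
      connectedComponentIn ρᶜ y := by
    rw [connectedComponentIn_eq hwC]
    refine (hconv.isPreconnected.image _ hcont.continuousOn).subset_connectedComponentIn
      ⟨h ⟨w, hwU⟩, mul_self_pos.2 hσ, by simp⟩ ?_
    rintro _ ⟨q, hq, rfl⟩ hqρ
    have hq0 := (hρ' q).1 hqρ
    have hq' : 0 < q.1 * σ := hq
    rw [hq0, zero_mul] at hq'
    exact lt_irrefl _ hq'
  have hpath : Filter.Tendsto (fun ε : ℝ => (h.symm (ε * σ, 0) : X)) (𝓝[>] 0) (𝓝 z) := by
    have hc : Continuous fun ε : ℝ => (h.symm (ε * σ, 0) : X) := hcont.comp (by fun_prop)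
    have := hc.tendsto 0
    rw [zero_mul, ← h0, h.symm_apply_apply] at this
    exact this.mono_left nhdsWithin_le_nhds
  refine mem_closure_of_tendsto hpath ?_
  filter_upwards [self_mem_nhdsWithin] with ε hε
  refine ⟨(hβ' _).2 rfl, hside ⟨(ε * σ, 0), ?_, rfl⟩⟩
  change 0 < ε * σ * σ
  rw [mul_assoc]
  exact mul_pos hε (mul_self_pos.2 hσ)

theorem finite_inter_of_crossing {X : Type*} [TopologicalSpace X] {β ρ : Set X}
    (hc : IsCompact (β ∩ ρ))
    (h : ∀ z ∈ β ∩ ρ, ∃ (U : Set X) (_ : IsOpen U) (hz : z ∈ U) (h : U ≃ₜ ℝ × ℝ),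
      h ⟨z, hz⟩ = (0, 0) ∧ h '' {p : U | (p : X) ∈ β} = {q : ℝ × ℝ | q.2 = 0} ∧
      h '' {p : U | (p : X) ∈ ρ} = {q : ℝ × ℝ | q.1 = 0}) : (β ∩ ρ).Finite := by
  have key : ∀ z ∈ β ∩ ρ, ∃ U ∈ 𝓝 z, U ∩ (β ∩ ρ) ⊆ {z} := by
    intro z hz
    obtain ⟨U, hU, hzU, e, h0, hβ, hρ⟩ := h z hz
    refine ⟨U, hU.mem_nhds hzU, ?_⟩
    rintro w ⟨hwU, hwβ, hwρ⟩
    have h1 : e ⟨w, hwU⟩ ∈ {q : ℝ × ℝ | q.2 = 0} := hβ ▸ mem_image_of_mem e hwβ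
    have h2 : e ⟨w, hwU⟩ ∈ {q : ℝ × ℝ | q.1 = 0} := hρ ▸ mem_image_of_mem e hwρ
    have h3 : e ⟨w, hwU⟩ = e ⟨z, hzU⟩ := h0 ▸ Prod.ext h2 h1
    exact congrArg Subtype.val (e.injective h3)
  choose! U hU hUs using key
  obtain ⟨t, ht, hcov⟩ := hc.elim_nhds_subcover U hU
  refine t.finite_toSet.subset fun w hw => ?_
  obtain ⟨z, hz, hwz⟩ := mem_iUnion₂.1 (hcov hw)
  rw [hUs z (ht z hz) ⟨hwz, hw⟩]
  exact hz

/-- The sub-arc of `f` around a point `t` in a complementary component of `R` not containing the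
base point `f 0`. -/
theorem IsCurveParam.exists_Ioo_subset_component {X : Type*} [TopologicalSpace X] {f : ℝ → X}
    (hf : IsCurveParam f) {R : Set X} (hR : IsClosed R) (h0 : f 0 ∉ R) {q : X}
    (hq : f 0 ∉ connectedComponentIn Rᶜ q) {t : ℝ} (ht : t ∈ Ioo (0 : ℝ) 1)
    (htq : f t ∈ connectedComponentIn Rᶜ q) :
    ∃ s s', 0 < s ∧ s < t ∧ t < s' ∧ s' < 1 ∧ f s ∈ R ∧ f s' ∈ R ∧
      f '' Ioo s s' ⊆ connectedComponentIn Rᶜ q := by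
  have h1 : f 1 = f 0 := by simpa using hf.apply_add_one 0
  have htR : f t ∉ R := fun h => connectedComponentIn_subset _ _ htq h
  have hmeet : ∀ a b, t ∈ Icc a b → (f a = f 0 ∨ f b = f 0) → (Icc a b ∩ f ⁻¹' R).Nonempty := by
    intro a b htab hab
    by_contra hemp
    have hsub : f '' Icc a b ⊆ connectedComponentIn Rᶜ (f t) :=
      (isPreconnected_Icc.image f hf.continuous.continuousOn).subset_connectedComponentIn
        ⟨t, htab, rfl⟩ (by
          rintro _ ⟨s, hs, rfl⟩ hsR
          exact hemp ⟨s, hs, hsR⟩)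
    rw [← connectedComponentIn_eq htq] at hsub
    have hle := htab.1.trans htab.2
    rcases hab with h | h
    · exact hq (h ▸ hsub ⟨a, left_mem_Icc.2 hle, rfl⟩)
    · exact hq (h ▸ hsub ⟨b, right_mem_Icc.2 hle, rfl⟩)
  have hcl : IsClosed (f ⁻¹' R) := hR.preimage hf.continuous
  obtain ⟨s, ⟨hs, hsR⟩, hsmax⟩ := (isCompact_Icc.inter_right hcl).exists_isGreatest
    (hmeet 0 t (right_mem_Icc.2 ht.1.le) (Or.inl rfl))
  obtain ⟨s', ⟨hs', hsR'⟩, hsmin⟩ := (isCompact_Icc.inter_right hcl).exists_isLeast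
    (hmeet t 1 (left_mem_Icc.2 ht.2.le) (Or.inr h1))
  have hst : s < t := lt_of_le_of_ne hs.2 fun h => htR (h ▸ hsR)
  have hts' : t < s' := lt_of_le_of_ne hs'.1 fun h => htR (h ▸ hsR')
  refine ⟨s, s', lt_of_le_of_ne hs.1 fun h => h0 (h ▸ hsR), hst, hts',
    lt_of_le_of_ne hs'.2 fun h => h0 (h1 ▸ h ▸ hsR'), hsR, hsR', ?_⟩
  rw [connectedComponentIn_eq htq]
  refine (isPreconnected_Ioo.image f hf.continuous.continuousOn).subset_connectedComponentIn
    ⟨t, ⟨hst, hts'⟩, rfl⟩ ?_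
  rintro _ ⟨v, hv, rfl⟩ hvR
  rcases le_total v t with h | h
  · exact hv.1.not_ge (hsmax ⟨⟨hs.1.trans hv.1.le, h⟩, hvR⟩)
  · exact hv.2.not_ge (hsmin ⟨⟨h, hv.2.le.trans hs'.2⟩, hvR⟩)

/-- Each intersection point that is a limit of `f` within a component of `Rᶜ` not containing
`f 0` is an endpoint of a sub-arc of `f` through this component. -/
theorem IsCurveParam.exists_chord {X : Type*} [TopologicalSpace X] [T2Space X] {f : ℝ → X}
    (hf : IsCurveParam f) {R : Set X} (hR : IsClosed R) (hfin : (range f ∩ R).Finite)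
    (h0 : f 0 ∉ R) {q x : X} (hq : f 0 ∉ connectedComponentIn Rᶜ q) (hx : x ∈ range f ∩ R)
    (hcl : x ∈ closure (range f ∩ connectedComponentIn Rᶜ q)) :
    ∃ s s', 0 < s ∧ s < s' ∧ s' < 1 ∧ f s ∈ R ∧ f s' ∈ R ∧
      f '' Ioo s s' ⊆ connectedComponentIn Rᶜ q ∧ (f s = x ∨ f s' = x) := by
  obtain ⟨t₀, ht₀, rfl⟩ := hf.exists_mem_Ioo hx.1 fun h => h0 (h ▸ hx.2)
  have hPfin : (Ioo (0 : ℝ) 1 ∩ f ⁻¹' R).Finite := by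
    refine Finite.of_finite_image (f := f) (hfin.subset ?_) ?_
    · rintro _ ⟨t, ht, rfl⟩
      exact ⟨mem_range_self _, ht.2⟩
    · exact fun s hs t ht h => hf.eq_of_mem_Ioo h hs.1 ht.1
  have hnhds : ((Ioo (0 : ℝ) 1 ∩ f ⁻¹' R) \ {t₀})ᶜ ∈ 𝓝 t₀ :=
    (hPfin.subset sdiff_subset).isClosed.isOpen_compl.mem_nhds (by simp)
  obtain ⟨δ, hδ, hball⟩ := Metric.mem_nhds_iff.1 hnhds
  have hclosed : IsClosed (f '' (Icc 0 1 \ ball t₀ δ)) :=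
    ((isCompact_Icc.diff isOpen_ball).image hf.continuous).isClosed
  have hnot : f t₀ ∉ f '' (Icc 0 1 \ ball t₀ δ) := by
    rintro ⟨t, ⟨ht, htb⟩, h⟩
    have : t = t₀ := hf.eq_of_abs_lt h
      (abs_lt.2 ⟨by linarith [ht.1, ht₀.2], by linarith [ht.2, ht₀.1]⟩)
    exact htb (this ▸ mem_ball_self hδ)
  obtain ⟨_, hyn, ⟨t', rfl⟩, hyC⟩ := mem_closure_iff.1 hcl _ hclosed.isOpen_compl hnot
  obtain ⟨t, ht, htt'⟩ := hf.exists_mem_Ioo (mem_range_self t') fun h => hq (h ▸ hyC)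
  rw [← htt'] at hyn hyC
  have htb : t ∈ ball t₀ δ := by
    by_contra hb
    exact hyn ⟨t, ⟨Ioo_subset_Icc_self ht, hb⟩, rfl⟩
  obtain ⟨s, s', hs0, hst, hts', hs1, hsR, hsR', hsub⟩ :=
    hf.exists_Ioo_subset_component hR h0 hq ht hyC
  refine ⟨s, s', hs0, hst.trans hts', hs1, hsR, hsR', hsub, ?_⟩
  have hne : t ≠ t₀ := by
    rintro rfl
    exact connectedComponentIn_subset _ _ hyC hx.2
  have hout : t₀ ∉ Ioo s s' := fun h =>
    connectedComponentIn_subset _ _ (hsub ⟨t₀, h, rfl⟩) hx.2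
  have huniq : ∀ v ∈ Ioo (0 : ℝ) 1, f v ∈ R → v ∈ ball t₀ δ → v = t₀ := by
    intro v hv hvR hvb
    by_contra hvt
    exact hball hvb ⟨⟨hv, hvR⟩, hvt⟩
  rw [mem_ball, Real.dist_eq, abs_lt] at htb
  rcases lt_or_gt_of_ne hne with h | h
  · right
    have : s' ≤ t₀ := not_lt.1 fun h' => hout ⟨hst.trans h, h'⟩
    rw [huniq s' ⟨ht.1.trans hts', hs1⟩ hsR' ?_]
    rw [mem_ball, Real.dist_eq, abs_lt]
    constructor <;> linarith
  · left
    have : t₀ ≤ s := not_lt.1 fun h' => hout ⟨h', h.trans hts'⟩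
    rw [huniq s ⟨hs0, hst.trans ht.2⟩ hsR ?_]
    rw [mem_ball, Real.dist_eq, abs_lt]
    constructor <;> linarith

/-- Two sub-arcs of `f` through the same side of `g` do not have interleaved endpoints. -/
theorem IsCurveParam.not_interleaved {f g : ℝ → ℂ} (hf : IsCurveParam f) (hg : IsCurveParam g)
    {p q : ℂ} (hp : p ∉ range g)
    (hpq : p ∉ connectedComponentIn (range g)ᶜ q) {s s' t t' u u' v v' : ℝ}
    (hs : 0 < s) (hss : s < s') (hs' : s' < 1) (ht : 0 < t) (htt : t < t') (ht' : t' < 1)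
    (hfs : f '' Ioo s s' ⊆ connectedComponentIn (range g)ᶜ q)
    (hft : f '' Ioo t t' ⊆ connectedComponentIn (range g)ᶜ q)
    (hsu : ({f s, f s'} : Set ℂ) = {g u, g u'}) (htv : ({f t, f t'} : Set ℂ) = {g v, g v'})
    (hu : 0 < u) (hu' : u' < 1) (hv : v ∈ Ioo u u') (hv' : v' ∈ Ioo 0 1) (hvu : v' ∉ Icc u u') :
    False := by
  set C := connectedComponentIn (range g)ᶜ q with hC
  have hCR : ∀ z ∈ C, z ∉ range g := fun z hz => connectedComponentIn_subset _ _ hz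
  have hend : ∀ z ∈ ({f s, f s'} : Set ℂ), z ∈ range g := by
    rw [hsu]; rintro z (rfl | rfl) <;> exact mem_range_self _
  have hend' : ∀ z ∈ ({f t, f t'} : Set ℂ), z ∈ range g := by
    rw [htv]; rintro z (rfl | rfl) <;> exact mem_range_self _
  have hαR : ∀ z ∈ f '' Icc s s', z ∈ range g → z = g u ∨ z = g u' := by
    rintro _ ⟨a, ha, rfl⟩ haR
    have : f a ∈ ({f s, f s'} : Set ℂ) := by
      rcases eq_or_lt_of_le ha.1 with rfl | h1
      · exact Or.inl rfl
      rcases eq_or_lt_of_le ha.2 with rfl | h2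
      · exact Or.inr rfl
      exact absurd haR (hCR _ (hfs ⟨a, ⟨h1, h2⟩, rfl⟩))
    rwa [hsu] at this
  have huv : ∀ a ∈ Ioo (0 : ℝ) 1, (g a = g u ∨ g a = g u') → a = u ∨ a = u' := by
    intro a ha h
    have huu := hv.1.trans hv.2
    exact h.imp (fun h => hg.eq_of_mem_Ioo h ha ⟨hu, huu.trans hu'⟩)
      fun h => hg.eq_of_mem_Ioo h ha ⟨hu.trans huu, hu'⟩
  have hv01 : v ∈ Ioo (0 : ℝ) 1 := ⟨hu.trans hv.1, hv.2.trans hu'⟩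
  have hvα : g v ∉ f '' Icc s s' := fun h => by
    rcases huv v hv01 (hαR _ h (mem_range_self _)) with h | h
    · exact hv.1.ne' h
    · exact hv.2.ne h
  have huu : u ≤ u' := (hv.1.trans hv.2).le
  have hvα' : g v' ∉ f '' Icc s s' := fun h => by
    rcases huv v' hv' (hαR _ h (mem_range_self _)) with h | h
    · exact hvu (h.symm ▸ left_mem_Icc.2 huu)
    · exact hvu (h.symm ▸ right_mem_Icc.2 huu)
  have hM : g '' Icc u u' ∪ g '' Icc u' (u + 1) = range g := by
    rw [← image_union, Icc_union_Icc_eq_Icc huu (by linarith), hg.range_eq u]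
  have hclT : ∀ z ∈ ({g v, g v'} : Set ℂ), z ∈ closure (f '' Ioo t t') := by
    rw [← htv]
    have : f '' Icc t t' ⊆ closure (f '' Ioo t t') := by
      rw [← closure_Ioo htt.ne]
      exact image_closure_subset_closure_image hf.continuous
    rintro z (rfl | rfl)
    · exact this ⟨t, left_mem_Icc.2 htt.le, rfl⟩
    · exact this ⟨t', right_mem_Icc.2 htt.le, rfl⟩
  have hfsR : ∀ a ∈ Ioo s s', f a ∉ range g := fun a ha => hCR _ (hfs ⟨a, ha, rfl⟩)
  have hftR : ∀ a ∈ Ioo t t', f a ∉ range g := fun a ha => hCR _ (hft ⟨a, ha, rfl⟩)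
  have hTα : Disjoint (f '' Ioo t t') (f '' Icc s s') := by
    rw [disjoint_left]
    rintro _ ⟨a, ha, rfl⟩ ⟨a', ha', h⟩
    obtain rfl : a' = a := hf.eq_of_mem_Ioo h ⟨hs.trans_le ha'.1, ha'.2.trans_lt hs'⟩
      ⟨ht.trans ha.1, ha.2.trans ht'⟩
    have e1 : a' ≠ s := fun h => hftR _ ha (h ▸ hend _ (Or.inl rfl))
    have e2 : a' ≠ s' := fun h => hftR _ ha (h ▸ hend _ (Or.inr rfl))
    have ha1 : s < a' := lt_of_le_of_ne ha'.1 e1.symm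
    have ha2 : a' < s' := lt_of_le_of_ne ha'.2 e2
    have e3 : t ≤ s := not_lt.1 fun h => hfsR t ⟨h, ha.1.trans ha2⟩ (hend' _ (Or.inl rfl))
    have e4 : s ≤ t := not_lt.1 fun h => hftR s ⟨h, ha1.trans ha.2⟩ (hend _ (Or.inl rfl))
    have e5 : t' ≤ s' := not_lt.1 fun h => hftR s' ⟨ha.1.trans ha2, h⟩ (hend _ (Or.inr rfl))
    have e6 : s' ≤ t' := not_lt.1 fun h => hfsR t' ⟨ha1.trans ha.2, h⟩ (hend' _ (Or.inr rfl))
    obtain rfl := le_antisymm e3 e4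
    obtain rfl := le_antisymm e5 e6
    have : g v ∈ ({f t, f t'} : Set ℂ) := htv ▸ Or.inl rfl
    refine hvα ?_
    rcases this with h | h
    · exact h ▸ ⟨t, left_mem_Icc.2 htt.le, rfl⟩
    · exact h ▸ ⟨t', right_mem_Icc.2 htt.le, rfl⟩
  have hne : connectedComponentIn (range g)ᶜ q ≠ connectedComponentIn (range g)ᶜ p :=
    fun h => hpq (by rw [hC, h]; exact mem_connectedComponentIn hp)
  have hdis := disjoint_connectedComponentIn hne
  have hinter : ∀ a ∈ Icc u u', ∀ b ∈ Icc u' (u + 1), g a = g b → a = u ∨ a = u' := by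
    intro a ha b hb hab
    by_contra! hcon
    have ha1 : u < a := lt_of_le_of_ne ha.1 hcon.1.symm
    have ha2 : a < u' := lt_of_le_of_ne ha.2 hcon.2
    have := hg.eq_of_abs_lt hab (abs_lt.2 ⟨by linarith [hb.2], by linarith [hb.1]⟩)
    linarith [hb.1]
  have huα : ∀ z ∈ ({g u, g u'} : Set ℂ), z ∈ f '' Icc s s' := by
    rw [← hsu]
    rintro z (rfl | rfl)
    · exact ⟨s, left_mem_Icc.2 hss.le, rfl⟩
    · exact ⟨s', right_mem_Icc.2 hss.le, rfl⟩
  have hm : (t + t') / 2 ∈ Ioo t t' := ⟨by linarith, by linarith⟩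
  have key := connectedComponentIn_eq_of_crossing_chord (M₁ := g '' Icc u u')
    (M₂ := g '' Icc u' (u + 1)) (α := f '' Icc s s') (T := f '' Ioo t t')
    (D := connectedComponentIn (range g)ᶜ p) (c := g v) (d := g v') (u := f ((t + t') / 2))
    (w := p)
    (isCompact_Icc.image hg.continuous) (isCompact_Icc.image hg.continuous)
    (isCompact_Icc.image hf.continuous)
    (isPreconnected_Icc.image f hf.continuous.continuousOn) ?_
    (isPreconnected_Ioo.image f hf.continuous.continuousOn) isPreconnected_connectedComponentIn
    ?_ ?_ ?_ ?_ (hclT _ (Or.inl rfl)) (hg.range_subset_closure hp (mem_range_self _))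
    (hclT _ (Or.inr rfl)) (hg.range_subset_closure hp (mem_range_self _)) ⟨_, hm, rfl⟩
    (mem_connectedComponentIn hp)
  · rw [hM, ← connectedComponentIn_eq (hft ⟨_, hm, rfl⟩)] at key
    exact hne key
  · rintro _ ⟨⟨a, ha, rfl⟩, b, hb, hab⟩
    rcases hinter a ha b hb hab.symm with rfl | rfl
    · exact huα _ (Or.inl rfl)
    · exact huα _ (Or.inr rfl)
  · rw [hM, disjoint_union_right]
    exact ⟨disjoint_left.2 fun z hz => hCR z (hft hz), hTα⟩
  · rw [hM, disjoint_union_right]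
    refine ⟨disjoint_left.2 fun z hz => connectedComponentIn_subset _ _ hz, ?_⟩
    rw [disjoint_right]
    intro z hzα hzp
    by_cases hzR : z ∈ range g
    · exact connectedComponentIn_subset _ _ hzp hzR
    · refine disjoint_right.1 hdis hzp ?_
      obtain ⟨a, ha, rfl⟩ := hzα
      refine hfs ⟨a, ⟨lt_of_le_of_ne ha.1 ?_, lt_of_le_of_ne ha.2 ?_⟩, rfl⟩
      · rintro rfl; exact hzR (hend _ (Or.inl rfl))
      · rintro rfl; exact hzR (hend _ (Or.inr rfl))
  · rintro (⟨b, hb, h⟩ | h)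
    · rcases hinter v (Ioo_subset_Icc_self hv) b hb h.symm with h | h
      · exact hv.1.ne' h
      · exact hv.2.ne h
    · exact hvα h
  · rintro (⟨b, hb, h⟩ | h)
    · have := hg.eq_of_mem_Ioo h ⟨hu.trans_le hb.1, hb.2.trans_lt hu'⟩ hv'
      exact hvu (this ▸ hb)
    · exact hvα' h

/-- The existence of a digon avoiding the base points, in terms of parametrizations. -/
theorem IsCurveParam.exists_digon {f g : ℝ → ℂ} (hf : IsCurveParam f) (hg : IsCurveParam g)
    (hf0 : f 0 ∉ range g) (hg0 : g 0 ∉ range f) (hfin : (range f ∩ range g).Finite)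
    (hne : (range f ∩ range g).Nonempty)
    (hloc : ∀ x ∈ range f ∩ range g, ∀ y,
      x ∈ closure (connectedComponentIn (range g)ᶜ y) →
      x ∈ closure (range f ∩ connectedComponentIn (range g)ᶜ y)) :
    ∃ s s' u u', 0 < s ∧ s < s' ∧ s' < 1 ∧ 0 < u ∧ u < u' ∧ u' < 1 ∧
      ({f s, f s'} : Set ℂ) = {g u, g u'} ∧ (∀ a ∈ Ioo s s', f a ∉ range g) ∧
      ∀ a ∈ Ioo u u', g a ∉ range f := by
  obtain ⟨q, hq, hqne⟩ := hg.exists_connectedComponentIn_ne (f 0)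
  have h0C : f 0 ∉ connectedComponentIn (range g)ᶜ q :=
    disjoint_right.1 (disjoint_connectedComponentIn hqne) (mem_connectedComponentIn hf0)
  let Q : Set ℝ := Ioo 0 1 ∩ g ⁻¹' range f
  have hQfin : Q.Finite := by
    refine Finite.of_finite_image (f := g) (hfin.subset ?_) ?_
    · rintro _ ⟨t, ht, rfl⟩
      exact ⟨ht.2, mem_range_self _⟩
    · exact fun s hs t ht h => hg.eq_of_mem_Ioo h hs.1 ht.1
  let Chord : ℝ → ℝ → Prop := fun u u' => ∃ s s', 0 < s ∧ s < s' ∧ s' < 1 ∧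
    f '' Ioo s s' ⊆ connectedComponentIn (range g)ᶜ q ∧ ({f s, f s'} : Set ℂ) = {g u, g u'}
  have hsymm : ∀ u u', Chord u u' → Chord u' u := by
    rintro u u' ⟨s, s', h1, h2, h3, h4, h5⟩
    exact ⟨s, s', h1, h2, h3, h4, by rw [h5, pair_comm]⟩
  have hpartner : ∀ u ∈ Q, ∃ u' ∈ Q, u' ≠ u ∧ Chord u u' := by
    intro u hu
    have hx : g u ∈ range f ∩ range g := ⟨hu.2, mem_range_self _⟩
    obtain ⟨s, s', hs, hss, hs', hsR, hsR', hsub, hor⟩ :=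
      hf.exists_chord hg.isCompact_range.isClosed hfin hf0 h0C hx
        (hloc _ hx q (hg.range_subset_closure hq hx.2))
    have hff : f s ≠ f s' := fun h =>
      hss.ne (hf.eq_of_mem_Ioo h ⟨hs, hss.trans hs'⟩ ⟨hs.trans hss, hs'⟩)
    have hparam : ∀ a, f a ∈ range g → ∃ w ∈ Q, g w = f a := by
      intro a ha
      obtain ⟨w, hw, hwa⟩ := hg.exists_mem_Ioo ha fun h => hg0 (h ▸ mem_range_self _)
      exact ⟨w, ⟨hw, a, hwa.symm⟩, hwa⟩
    rcases hor with h | h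
    · obtain ⟨w, hw, hwa⟩ := hparam s' hsR'
      refine ⟨w, hw, ?_, s, s', hs, hss, hs', hsub, by rw [h, hwa]⟩
      rintro rfl
      exact hff (h.trans hwa)
    · obtain ⟨w, hw, hwa⟩ := hparam s hsR
      refine ⟨w, hw, ?_, s, s', hs, hss, hs', hsub, by rw [h, hwa, pair_comm]⟩
      rintro rfl
      exact hff (hwa.symm.trans h.symm)
  let W : Set (ℝ × ℝ) := {p | p ∈ Q ×ˢ Q ∧ p.1 < p.2 ∧ Chord p.1 p.2}
  have hWfin : W.Finite := (hQfin.prod hQfin).subset fun p hp => hp.1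
  have hWne : W.Nonempty := by
    obtain ⟨x, hxf, hxg⟩ := hne
    obtain ⟨u, hu, rfl⟩ := hg.exists_mem_Ioo hxg fun h => hg0 (h ▸ hxf)
    obtain ⟨u', hu', hne', hch⟩ := hpartner u ⟨hu, hxf⟩
    rcases lt_or_gt_of_ne hne' with h | h
    · exact ⟨(u', u), ⟨hu', hu, hxf⟩, h, hsymm _ _ hch⟩
    · exact ⟨(u, u'), ⟨⟨hu, hxf⟩, hu'⟩, h, hch⟩
  obtain ⟨⟨u, u'⟩, ⟨⟨hu, hu'⟩, huu, s, s', hs, hss, hs', hsub, hpair⟩, hmin⟩ :=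
    exists_min_image W (fun p => p.2 - p.1) hWfin hWne
  refine ⟨s, s', u, u', hs, hss, hs', hu.1.1, huu, hu'.1.2, hpair, fun a ha =>
    connectedComponentIn_subset _ _ (hsub ⟨a, ha, rfl⟩), fun v hv hvf => ?_⟩
  have hvQ : v ∈ Q := ⟨⟨hu.1.1.trans hv.1, hv.2.trans hu'.1.2⟩, hvf⟩
  obtain ⟨v', hv', hvne, hch⟩ := hpartner v hvQ
  by_cases hvu : v' ∈ Icc u u'
  · rcases lt_or_gt_of_ne hvne with h | h
    · have := hmin (v', v) ⟨⟨hv', hvQ⟩, h, hsymm _ _ hch⟩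
      simp only at this
      linarith [hv.2, hvu.1]
    · have := hmin (v, v') ⟨⟨hvQ, hv'⟩, h, hch⟩
      simp only at this
      linarith [hv.1, hvu.2]
  · obtain ⟨t, t', ht, htt, ht', htsub, htpair⟩ := hch
    exact hf.not_interleaved hg hf0 h0C hs hss hs' ht htt ht' hsub htsub hpair htpair hu.1.1
      hu'.1.2 hv hv'.1 hvu

theorem IsSimpleClosedCurve.exists_isCurveParam {c : Set (ℝ × ℝ)} (hc : IsSimpleClosedCurve c)
    {b : ℝ × ℝ} (hb : b ∈ c) : ∃ f : ℝ → ℝ × ℝ, IsCurveParam f ∧ range f = c ∧ f 0 = b := by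
  obtain ⟨e⟩ := hc
  let φ := Complex.orthonormalBasisOneI.repr
  let k : ℝ → sphere (0 : EuclideanSpace ℝ (Fin 2)) 1 := fun t =>
    ⟨φ (Circle.exp (t * (2 * Real.pi))), by
      rw [mem_sphere_zero_iff_norm, φ.norm_map, Circle.norm_coe]⟩
  have hk : Continuous k := by
    refine Continuous.subtype_mk (φ.continuous.comp ?_) _
    fun_prop
  have hkeq : ∀ s t, k s = k t ↔ ∃ n : ℤ, s - t = n := by
    intro s t
    simp only [k, Subtype.mk.injEq, φ.injective.eq_iff, Circle.coe_inj, Circle.exp_eq_exp]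
    refine exists_congr fun n => ?_
    rw [← add_mul, mul_left_inj' (by positivity)]
    constructor <;> intro h <;> linarith
  have hksurj : Function.Surjective k := by
    intro x
    have hx : ‖φ.symm x‖ = 1 := by simp
    refine ⟨(φ.symm x).arg / (2 * Real.pi), Subtype.ext ?_⟩
    simp only [k]
    rw [div_mul_cancel₀ _ (by positivity), Circle.coe_exp]
    have := Complex.norm_mul_exp_arg_mul_I (φ.symm x)
    rw [hx, Complex.ofReal_one, one_mul] at this
    rw [this, φ.apply_symm_apply]
  have hparam : IsCurveParam fun t => (e.symm (k t) : ℝ × ℝ) :=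
    ⟨continuous_subtype_val.comp (e.symm.continuous.comp hk), fun s t => by
      rw [Subtype.val_injective.eq_iff, e.symm.injective.eq_iff, hkeq]⟩
  obtain ⟨t₀, ht₀⟩ := hksurj (e ⟨b, hb⟩)
  refine ⟨_, hparam.comp_add t₀, ?_, by simp [ht₀]⟩
  ext x
  constructor
  · rintro ⟨t, rfl⟩
    exact (e.symm (k (t + t₀))).2
  · intro hx
    obtain ⟨t, ht⟩ := hksurj (e ⟨x, hx⟩)
    exact ⟨t - t₀, by simp [ht]⟩

theorem IsCrossing.image {β ρ : Set (ℝ × ℝ)} {z : ℝ × ℝ} (h : IsCrossing β ρ z) {X : Type*}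
    [TopologicalSpace X] (e : ℝ × ℝ ≃ₜ X) :
    ∃ (U : Set X) (_ : IsOpen U) (hz : e z ∈ U) (h : U ≃ₜ ℝ × ℝ),
      h ⟨e z, hz⟩ = (0, 0) ∧ h '' {p : U | (p : X) ∈ e '' β} = {q : ℝ × ℝ | q.2 = 0} ∧
      h '' {p : U | (p : X) ∈ e '' ρ} = {q : ℝ × ℝ | q.1 = 0} := by
  obtain ⟨U, hU, hz, k, h0, hβ, hρ⟩ := h
  have himg : ∀ S : Set (ℝ × ℝ), ((e.image U).symm.trans k) '' {p | (p : X) ∈ e '' S} =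
      k '' {p : U | (p : ℝ × ℝ) ∈ S} := by
    intro S
    ext q
    constructor
    · rintro ⟨⟨_, x, hx, rfl⟩, ⟨y, hy, hxy⟩, rfl⟩
      obtain rfl := e.injective hxy
      exact ⟨⟨y, hx⟩, hy, congrArg k ((e.image U).symm_apply_apply ⟨y, hx⟩).symm⟩
    · rintro ⟨x, hx, rfl⟩
      exact ⟨e.image U x, ⟨x, hx, rfl⟩, congrArg k ((e.image U).symm_apply_apply x)⟩
  refine ⟨e '' U, e.isOpenMap _ hU, ⟨z, hz, rfl⟩, (e.image U).symm.trans k, ?_, ?_, ?_⟩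
  · rw [← h0]
    exact congrArg k ((e.image U).symm_apply_apply ⟨z, hz⟩)
  · rw [himg, hβ]
  · rw [himg, hρ]

theorem isArc_image_Icc {f : ℝ → ℝ × ℝ} {a b : ℝ} (hab : a < b) (hf : Continuous f)
    (hi : InjOn f (Icc a b)) : IsArc (f '' Icc a b) := by
  have hc : Continuous ((Icc a b).domRestrict f) :=
    continuousOn_iff_continuous_domRestrict.1 hf.continuousOn
  have hinj : Function.Injective ((Icc a b).domRestrict f) := injOn_iff_injective.1 hi
  have e := (hc.isClosedEmbedding hinj).isEmbedding.toHomeomorph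
  have hr : range ((Icc a b).domRestrict f) = f '' Icc a b := range_domRestrict f _
  rw [IsArc, ← hr]
  exact ⟨e.symm.trans (iccHomeoI a b hab)⟩

theorem setOf_isEndpointOf_image_Icc {f : ℝ → ℝ × ℝ} {a b : ℝ} (hab : a < b)
    (hf : Continuous f) (hi : InjOn f (Icc a b)) :
    {x | IsEndpointOf x (f '' Icc a b)} = {f a, f b} := by
  have hdiff : ∀ t ∈ Icc a b, f '' Icc a b \ {f t} = f '' (Icc a b \ {t}) := by
    intro t ht
    rw [hi.image_sdiff_subset (singleton_subset_iff.2 ht), image_singleton]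
  ext x
  constructor
  · rintro ⟨⟨t, ht, rfl⟩, hconn⟩
    by_contra hx
    have hta : a < t := lt_of_le_of_ne ht.1 fun h => hx (Or.inl (by rw [h]))
    have htb : t < b := lt_of_le_of_ne ht.2 fun h => hx (Or.inr (by rw [h]; rfl))
    have hcl : ∀ c d, IsClosed (f '' Icc c d) := fun c d => (isCompact_Icc.image hf).isClosed
    obtain ⟨_, ⟨-, hne⟩, ⟨c, hc, rfl⟩, d, hd, hcd⟩ :=
      isPreconnected_closed_iff.1 hconn.isPreconnected (f '' Icc a t) (f '' Icc t b) (hcl _ _)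
        (hcl _ _) (by
          rw [← image_union, Icc_union_Icc_eq_Icc ht.1 ht.2]
          exact fun _ h => h.1)
        (by
          rw [hdiff t ht]
          exact ⟨f a, ⟨a, ⟨left_mem_Icc.2 hab.le, hta.ne⟩, rfl⟩, a, left_mem_Icc.2 ht.1, rfl⟩)
        (by
          rw [hdiff t ht]
          exact ⟨f b, ⟨b, ⟨right_mem_Icc.2 hab.le, htb.ne'⟩, rfl⟩, b, right_mem_Icc.2 ht.2, rfl⟩)
    obtain rfl := hi ⟨ht.1.trans hd.1, hd.2⟩ ⟨hc.1, hc.2.trans ht.2⟩ hcd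
    exact hne (congrArg f (le_antisymm hc.2 hd.1))
  · rintro (rfl | rfl)
    · have ha := left_mem_Icc.2 hab.le
      refine ⟨⟨a, ha, rfl⟩, ?_⟩
      rw [hdiff a ha, Icc_sdiff_left]
      exact (isConnected_Ioc hab).image f hf.continuousOn
    · have hb := right_mem_Icc.2 hab.le
      refine ⟨⟨b, hb, rfl⟩, ?_⟩
      rw [hdiff b hb, Icc_sdiff_right]
      exact (isConnected_Ico hab).image f hf.continuousOn

theorem inter_image_Icc_eq {f : ℝ → ℝ × ℝ} {S : Set (ℝ × ℝ)} {a b : ℝ} (hab : a ≤ b)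
    (ha : f a ∈ S) (hb : f b ∈ S) (h : ∀ t ∈ Ioo a b, f t ∉ S) :
    S ∩ f '' Icc a b = {f a, f b} := by
  ext x
  constructor
  · rintro ⟨hx, t, ht, rfl⟩
    rcases eq_or_lt_of_le ht.1 with rfl | h1
    · exact Or.inl rfl
    rcases eq_or_lt_of_le ht.2 with rfl | h2
    · exact Or.inr rfl
    exact absurd hx (h t ⟨h1, h2⟩)
  · rintro (rfl | rfl)
    · exact ⟨ha, a, left_mem_Icc.2 hab, rfl⟩
    · exact ⟨hb, b, right_mem_Icc.2 hab, rfl⟩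

theorem IsCurveParam.apply_zero_notMem_image_Icc {f : ℝ → ℝ × ℝ} (hf : IsCurveParam f) {a b : ℝ}
    (ha : 0 < a) (hb : b < 1) : f 0 ∉ f '' Icc a b := by
  rintro ⟨t, ht, h⟩
  have := hf.eq_of_abs_lt h (abs_lt.2 ⟨by linarith [ht.1], by linarith [ht.2]⟩)
  linarith [ht.1]

/-- If two non-disjoint simple closed curves intersect only in crossings, then for any point
`b` of `β` not on `ρ` and any point `r` of `ρ` not on `β`, there is a digon avoiding both. -/
theorem exists_digon_avoiding_two_points
    (β ρ : Set (ℝ × ℝ))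
    (hβ : IsSimpleClosedCurve β) (hρ : IsSimpleClosedCurve ρ)
    (hne : (β ∩ ρ).Nonempty)
    (hcr : ∀ z ∈ β ∩ ρ, IsCrossing β ρ z)
    (b : ℝ × ℝ) (hb : b ∈ β \ ρ)
    (r : ℝ × ℝ) (hr : r ∈ ρ \ β) :
    ∃ α γ : Set (ℝ × ℝ), IsDigon β ρ α γ ∧ b ∉ α ∪ γ ∧ r ∉ α ∪ γ := by
  obtain ⟨f, hf, rfl, rfl⟩ := hβ.exists_isCurveParam hb.1
  obtain ⟨g, hg, rfl, rfl⟩ := hρ.exists_isCurveParam hr.1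
  have hfin : (range f ∩ range g).Finite :=
    finite_inter_of_crossing (hf.isCompact_range.inter hg.isCompact_range) hcr
  let e : ℝ × ℝ ≃ₜ ℂ := Complex.equivRealProdCLM.symm.toHomeomorph
  have hrange : ∀ k : ℝ → ℝ × ℝ, range (fun t => e (k t)) = e '' range k := fun k => range_comp e k
  have hmem : ∀ (k : ℝ → ℝ × ℝ) x, e x ∈ range (fun t => e (k t)) ↔ x ∈ range k := by
    intro k x
    rw [hrange, e.injective.mem_set_image]
  have hinter : range (fun t => e (f t)) ∩ range (fun t => e (g t)) =
      e '' (range f ∩ range g) := by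
    rw [hrange, hrange, image_inter e.injective]
  obtain ⟨s, s', u, u', hs, hss, hs', hu, huu, hu', hpair, hsR, huR⟩ :=
    (hf.comp_homeomorph e).exists_digon (hg.comp_homeomorph e) (by rw [hmem]; exact hb.2)
      (by rw [hmem]; exact hr.2) (hinter ▸ hfin.image e) (hinter ▸ hne.image e) (by
        rw [hinter]
        rintro _ ⟨x, hx, rfl⟩ y hy
        obtain ⟨U, hU, hz, h, h0, h1, h2⟩ := (hcr x hx).image e
        rw [hrange] at hy ⊢
        rw [hrange]
        exact mem_closure_inter_of_crossing hU hz h h0 h1 h2 hy)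
  simp only [hmem] at hsR huR
  have hpair' : ({f s, f s'} : Set (ℝ × ℝ)) = {g u, g u'} := by
    apply e.injective.image_injective
    simpa only [image_pair] using hpair
  have hfi := hf.injOn_Icc (a := s) (b := s') (by linarith)
  have hgi := hg.injOn_Icc (a := u) (b := u') (by linarith)
  have hfsR : ∀ x ∈ ({f s, f s'} : Set (ℝ × ℝ)), x ∈ range g := by
    rw [hpair']; rintro x (rfl | rfl) <;> exact mem_range_self _
  have hguR : ∀ x ∈ ({g u, g u'} : Set (ℝ × ℝ)), x ∈ range f := by
    rw [← hpair']; rintro x (rfl | rfl) <;> exact mem_range_self _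
  refine ⟨f '' Icc s s', g '' Icc u u', ⟨isArc_image_Icc hss hf.continuous hfi,
    isArc_image_Icc huu hg.continuous hgi, image_subset_range _ _, image_subset_range _ _,
    f s, f s', fun h => hss.ne (hfi (left_mem_Icc.2 hss.le) (right_mem_Icc.2 hss.le) h),
    setOf_isEndpointOf_image_Icc hss hf.continuous hfi, ?_, ?_, ?_⟩, ?_, ?_⟩
  · rw [hpair']
    exact setOf_isEndpointOf_image_Icc huu hg.continuous hgi
  · rw [hpair']
    exact inter_image_Icc_eq huu.le (hguR _ (Or.inl rfl)) (hguR _ (Or.inr rfl)) huR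
  · exact inter_image_Icc_eq hss.le (hfsR _ (Or.inl rfl)) (hfsR _ (Or.inr rfl)) hsR
  · rintro (h | h)
    · exact hf.apply_zero_notMem_image_Icc hs hs' h
    · exact hb.2 (image_subset_range _ _ h)
  · rintro (h | h)
    · exact hr.2 (image_subset_range _ _ h)
    · exact hg.apply_zero_notMem_image_Icc hu hu' h
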